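/- Let A ∈ ℝ^{p × q} and B ∈ ℝ^{r × s} be real matrices. Then the spectral norm (operator norm with respect to Euclidean norms) of their Kronecker product satisfies ‖A ⊗ B‖₂ = ‖A‖₂ · ‖B‖₂. -/

import Mathlib

open scoped BigOperators
open scoped Kronecker

/-- The Euclidean norm of a vector. -/
noncomputable def enorm {ι : Type*} [Fintype ι] (v : ι → ℝ) : ℝ :=
  Real.sqrt (∑ i, v i ^ 2)

/-- The spectral norm of a real matrix: its operator norm with respect to Euclidean
norms, i.e. the supremum of `‖M x‖₂` over unit vectors `x`. -/
noncomputable def specNorm {α β : Type*} [Fintype α] [Fintype β]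
    (M : Matrix α β ℝ) : ℝ :=
  sSup {c : ℝ | ∃ x : β → ℝ, _root_.enorm x = 1 ∧ c = _root_.enorm (M.mulVec x)}

theorem enorm_nonneg {ι : Type*} [Fintype ι] (v : ι → ℝ) : 0 ≤ _root_.enorm v :=
  Real.sqrt_nonneg _

theorem enorm_sq {ι : Type*} [Fintype ι] (v : ι → ℝ) : _root_.enorm v ^ 2 = ∑ i, v i ^ 2 :=
  Real.sq_sqrt (Finset.sum_nonneg fun _ _ => sq_nonneg _)

theorem enorm_const_smul {ι : Type*} [Fintype ι] (c : ℝ) (v : ι → ℝ) :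
    _root_.enorm (c • v) = |c| * _root_.enorm v := by
  simp only [_root_.enorm, Pi.smul_apply, smul_eq_mul, mul_pow, ← Finset.mul_sum]
  rw [Real.sqrt_mul (sq_nonneg c), Real.sqrt_sq_eq_abs]

theorem specNorm_nonneg {α β : Type*} [Fintype α] [Fintype β] (M : Matrix α β ℝ) :
    0 ≤ specNorm M := by
  refine Real.sSup_nonneg ?_
  rintro _ ⟨x, -, rfl⟩
  exact enorm_nonneg _

theorem enorm_mulVec_le_specNorm {α β : Type*} [Fintype α] [Fintype β]
    (M : Matrix α β ℝ) {x : β → ℝ} (hx : _root_.enorm x = 1) :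
    _root_.enorm (M.mulVec x) ≤ specNorm M := by
  refine le_csSup ⟨Real.sqrt (∑ i, ∑ j, M i j ^ 2), ?_⟩ ⟨x, hx, rfl⟩
  rintro _ ⟨y, hy, rfl⟩
  refine Real.sqrt_le_sqrt (Finset.sum_le_sum fun i _ => ?_)
  have h := Finset.sum_mul_sq_le_sq_mul_sq Finset.univ (M i) y
  rwa [← enorm_sq y, hy, one_pow, mul_one] at h

theorem enorm_mulVec_le {α β : Type*} [Fintype α] [Fintype β]
    (M : Matrix α β ℝ) (x : β → ℝ) :
    _root_.enorm (M.mulVec x) ≤ specNorm M * _root_.enorm x := by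
  rcases (enorm_nonneg x).eq_or_lt with h | h
  · have hx : x = 0 := by
      have hs := enorm_sq x
      rw [← h, zero_pow two_ne_zero, eq_comm,
        Finset.sum_eq_zero_iff_of_nonneg fun _ _ => sq_nonneg _] at hs
      funext i
      simpa using hs i (Finset.mem_univ i)
    simp [hx, _root_.enorm]
  · have hu : _root_.enorm ((_root_.enorm x)⁻¹ • x) = 1 := by
      rw [enorm_const_smul, abs_of_pos (inv_pos.2 h), inv_mul_cancel₀ h.ne']
    have := enorm_mulVec_le_specNorm M hu
    rwa [Matrix.mulVec_smul, enorm_const_smul, abs_of_pos (inv_pos.2 h), inv_mul_le_iff₀ h,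
      mul_comm] at this

theorem sum_mulVec_sq_le {α β : Type*} [Fintype α] [Fintype β]
    (M : Matrix α β ℝ) (v : β → ℝ) :
    ∑ i, M.mulVec v i ^ 2 ≤ specNorm M ^ 2 * ∑ j, v j ^ 2 := by
  rw [← enorm_sq, ← enorm_sq, ← mul_pow]
  exact pow_le_pow_left₀ (enorm_nonneg _) (enorm_mulVec_le M v) 2

theorem mul_specNorm_le {α β : Type*} [Fintype α] [Fintype β]
    (M : Matrix α β ℝ) {c C : ℝ} (hc : 0 ≤ c) (hC : 0 ≤ C)
    (h : ∀ x, _root_.enorm x = 1 → c * _root_.enorm (M.mulVec x) ≤ C) :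
    c * specNorm M ≤ C := by
  rcases hc.eq_or_lt with rfl | hc
  · simpa using hC
  · rw [← le_div_iff₀' hc]
    refine Real.sSup_le ?_ (div_nonneg hC hc.le)
    rintro _ ⟨x, hx, rfl⟩
    exact (le_div_iff₀' hc).2 (h x hx)

theorem kronecker_mulVec_apply {α β γ δ : Type*} [Fintype β] [Fintype δ]
    (A : Matrix α β ℝ) (B : Matrix γ δ ℝ) (x : β × δ → ℝ) (i : α) (k : γ) :
    (A ⊗ₖ B).mulVec x (i, k) =
      A.mulVec (fun j => B.mulVec (fun l => x (j, l)) k) i := by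
  simp [Matrix.mulVec, dotProduct, Fintype.sum_prod_type, Finset.mul_sum, mul_assoc]

theorem enorm_tensor {α β : Type*} [Fintype α] [Fintype β] (x : α → ℝ) (y : β → ℝ) :
    _root_.enorm (fun z : α × β => x z.1 * y z.2) = _root_.enorm x * _root_.enorm y := by
  rw [_root_.enorm, _root_.enorm, _root_.enorm,
    ← Real.sqrt_mul (Finset.sum_nonneg fun _ _ => sq_nonneg _), Finset.sum_mul_sum]
  simp only [Fintype.sum_prod_type, mul_pow]

theorem enorm_kronecker_mulVec_le {α β γ δ : Type*} [Fintype α] [Fintype β] [Fintype γ]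
    [Fintype δ] (A : Matrix α β ℝ) (B : Matrix γ δ ℝ) (x : β × δ → ℝ) :
    _root_.enorm ((A ⊗ₖ B).mulVec x) ≤ specNorm A * specNorm B * _root_.enorm x := by
  refine (sq_le_sq₀ (enorm_nonneg _) ?_).1 ?_
  · exact mul_nonneg (mul_nonneg (specNorm_nonneg A) (specNorm_nonneg B)) (enorm_nonneg x)
  calc _root_.enorm ((A ⊗ₖ B).mulVec x) ^ 2
      = ∑ k, ∑ i, A.mulVec (fun j => B.mulVec (fun l => x (j, l)) k) i ^ 2 := by
        rw [enorm_sq, Fintype.sum_prod_type_right]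
        simp only [kronecker_mulVec_apply]
    _ ≤ ∑ k, specNorm A ^ 2 * ∑ j, B.mulVec (fun l => x (j, l)) k ^ 2 :=
        Finset.sum_le_sum fun k _ => sum_mulVec_sq_le A _
    _ = specNorm A ^ 2 * ∑ j, ∑ k, B.mulVec (fun l => x (j, l)) k ^ 2 := by
        rw [← Finset.mul_sum, Finset.sum_comm]
    _ ≤ specNorm A ^ 2 * ∑ j, specNorm B ^ 2 * ∑ l, x (j, l) ^ 2 :=
        mul_le_mul_of_nonneg_left (Finset.sum_le_sum fun j _ => sum_mulVec_sq_le B _) (sq_nonneg _)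
    _ = (specNorm A * specNorm B * _root_.enorm x) ^ 2 := by
        rw [mul_pow, mul_pow, enorm_sq, Fintype.sum_prod_type, ← Finset.mul_sum, mul_assoc]

theorem kronecker_mulVec_tensor {α β γ δ : Type*} [Fintype β] [Fintype δ]
    (A : Matrix α β ℝ) (B : Matrix γ δ ℝ) (x : β → ℝ) (y : δ → ℝ) :
    (A ⊗ₖ B).mulVec (fun z => x z.1 * y z.2) = fun z => A.mulVec x z.1 * B.mulVec y z.2 := by
  funext ⟨i, k⟩
  simp [Matrix.mulVec, dotProduct, Fintype.sum_prod_type, Finset.sum_mul_sum, mul_mul_mul_comm]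

/-- the spectral norm of a Kronecker product satisfies
`‖A ⊗ B‖₂ = ‖A‖₂ · ‖B‖₂`. -/
theorem specNorm_kronecker {p q r s : ℕ}
    (A : Matrix (Fin p) (Fin q) ℝ) (B : Matrix (Fin r) (Fin s) ℝ) :
    specNorm (A ⊗ₖ B) = specNorm A * specNorm B := by
  have hAB := mul_nonneg (specNorm_nonneg A) (specNorm_nonneg B)
  apply le_antisymm
  · rw [← one_mul (specNorm (A ⊗ₖ B))]
    refine mul_specNorm_le _ zero_le_one hAB fun x hx => ?_
    simpa [hx] using enorm_kronecker_mulVec_le A B x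
  · refine mul_specNorm_le B (specNorm_nonneg A) (specNorm_nonneg _) fun y hy => ?_
    rw [mul_comm]
    refine mul_specNorm_le A (enorm_nonneg _) (specNorm_nonneg _) fun x hx => ?_
    rw [mul_comm, ← enorm_tensor, ← kronecker_mulVec_tensor]
    exact enorm_mulVec_le_specNorm _ (by rw [enorm_tensor, hx, hy, one_mul])
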